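/- arXiv:1009.0051 — 3 statements merged into one kernel-verified Lean document; each statement's English description precedes it below -/
import Mathlib

section
/- Let r = sqrt(x^2 + y^2). For every (x, y) ∈ ℝ² with (x, y) ≠ (0, 0) and every t ∈ ℝ with x^2 + y^2 + 2t > 0, the function u(x, y, t) = sqrt(x^2 + y^2 + 2t) − 1 satisfies the Perona–Malik level-set curvature equation ∂u/∂t = ((∂u/∂y)^2 ∂²u/∂x² − 2 (∂u/∂x)(∂u/∂y) ∂²u/∂x∂y + (∂u/∂x)^2 ∂²u/∂y²) / ((∂u/∂x)^2 + (∂u/∂y)^2), together with the initial condition u(x, y, 0) = sqrt(x^2 + y^2) − 1; in particular the gradient (∂u/∂x, ∂u/∂y) is nonzero at such points, so the right-hand side is well defined. -/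
/-- Partial derivative in the first (x) variable. -/
noncomputable def pderivX (v : ℝ → ℝ → ℝ) (x y : ℝ) : ℝ :=
  deriv (fun x' => v x' y) x

/-- Partial derivative in the second (y) variable. -/
noncomputable def pderivY (v : ℝ → ℝ → ℝ) (x y : ℝ) : ℝ :=
  deriv (fun y' => v x y') y

/-- The Perona–Malik level-set curvature operator
`N(v) = (v_y² v_xx − 2 v_x v_y v_xy + v_x² v_yy) / (v_x² + v_y²)`. -/
noncomputable def curvOp (v : ℝ → ℝ → ℝ) (x y : ℝ) : ℝ :=
  ((pderivY v x y) ^ 2 * pderivX (pderivX v) x y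
      - 2 * pderivX v x y * pderivY v x y * pderivY (pderivX v) x y
      + (pderivX v x y) ^ 2 * pderivY (pderivY v) x y)
    / ((pderivX v x y) ^ 2 + (pderivY v x y) ^ 2)

/-- The function `s ↦ √(s² + c)` has derivative `a / √(a² + c)` at `a` when `a² + c > 0`. -/
theorem hasDerivAt_sqrt_sq_add {a c : ℝ} (h : 0 < a ^ 2 + c) :
    HasDerivAt (fun s => Real.sqrt (s ^ 2 + c)) (a / Real.sqrt (a ^ 2 + c)) a := by
  have h1 : HasDerivAt (fun s : ℝ => s ^ 2 + c) (2 * a) a := by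
    simpa using (hasDerivAt_pow 2 a).add_const c
  refine (h1.sqrt h.ne').congr_deriv ?_
  have := (Real.sqrt_pos.2 h).ne'
  field_simp

theorem pderivX_sqrt {x y t : ℝ} (h : 0 < x ^ 2 + y ^ 2 + 2 * t) :
    pderivX (fun a b => Real.sqrt (a ^ 2 + b ^ 2 + 2 * t) - 1) x y
      = x / Real.sqrt (x ^ 2 + y ^ 2 + 2 * t) := by
  have := (hasDerivAt_sqrt_sq_add (a := x) (c := y ^ 2 + 2 * t) (by linarith)).sub_const 1
  simp only [← add_assoc] at this
  exact this.deriv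

theorem pderivY_sqrt {x y t : ℝ} (h : 0 < x ^ 2 + y ^ 2 + 2 * t) :
    pderivY (fun a b => Real.sqrt (a ^ 2 + b ^ 2 + 2 * t) - 1) x y
      = y / Real.sqrt (x ^ 2 + y ^ 2 + 2 * t) := by
  have := (hasDerivAt_sqrt_sq_add (a := y) (c := x ^ 2 + 2 * t) (by linarith)).sub_const 1
  simp only [← add_assoc, add_comm _ (x ^ 2)] at this
  exact this.deriv

theorem pderivX_pderivX_sqrt {x y t : ℝ} (h : 0 < x ^ 2 + y ^ 2 + 2 * t) :
    pderivX (pderivX fun a b => Real.sqrt (a ^ 2 + b ^ 2 + 2 * t) - 1) x y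
      = (y ^ 2 + 2 * t) / Real.sqrt (x ^ 2 + y ^ 2 + 2 * t) ^ 3 := by
  have hev : ∀ᶠ a in nhds x, 0 < a ^ 2 + y ^ 2 + 2 * t :=
    (by fun_prop : Continuous fun a : ℝ => a ^ 2 + y ^ 2 + 2 * t).continuousAt.eventually_const_lt h
  have heq : (fun a => pderivX (fun a b => Real.sqrt (a ^ 2 + b ^ 2 + 2 * t) - 1) a y)
      =ᶠ[nhds x] fun a => a / Real.sqrt (a ^ 2 + y ^ 2 + 2 * t) :=
    hev.mono fun _ ha => pderivX_sqrt ha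
  have hw := (Real.sqrt_pos.2 h).ne'
  have hd := hasDerivAt_sqrt_sq_add (a := x) (c := y ^ 2 + 2 * t) (by linarith)
  simp only [← add_assoc] at hd
  refine heq.deriv_eq.trans (((hasDerivAt_id' x).fun_div hd hw).deriv.trans ?_)
  have hsq := Real.sq_sqrt h.le
  field_simp
  linarith

theorem pderivY_pderivY_sqrt {x y t : ℝ} (h : 0 < x ^ 2 + y ^ 2 + 2 * t) :
    pderivY (pderivY fun a b => Real.sqrt (a ^ 2 + b ^ 2 + 2 * t) - 1) x y
      = (x ^ 2 + 2 * t) / Real.sqrt (x ^ 2 + y ^ 2 + 2 * t) ^ 3 := by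
  have hev : ∀ᶠ b in nhds y, 0 < x ^ 2 + b ^ 2 + 2 * t :=
    (by fun_prop : Continuous fun b : ℝ => x ^ 2 + b ^ 2 + 2 * t).continuousAt.eventually_const_lt h
  have heq : (fun b => pderivY (fun a b => Real.sqrt (a ^ 2 + b ^ 2 + 2 * t) - 1) x b)
      =ᶠ[nhds y] fun b => b / Real.sqrt (x ^ 2 + b ^ 2 + 2 * t) :=
    hev.mono fun _ hb => pderivY_sqrt hb
  have hw := (Real.sqrt_pos.2 h).ne'
  have hd := hasDerivAt_sqrt_sq_add (a := y) (c := x ^ 2 + 2 * t) (by linarith)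
  simp only [← add_assoc, add_comm _ (x ^ 2)] at hd
  refine heq.deriv_eq.trans (((hasDerivAt_id' y).fun_div hd hw).deriv.trans ?_)
  have hsq := Real.sq_sqrt h.le
  field_simp
  linarith

theorem pderivY_pderivX_sqrt {x y t : ℝ} (h : 0 < x ^ 2 + y ^ 2 + 2 * t) :
    pderivY (pderivX fun a b => Real.sqrt (a ^ 2 + b ^ 2 + 2 * t) - 1) x y
      = -(x * y) / Real.sqrt (x ^ 2 + y ^ 2 + 2 * t) ^ 3 := by
  have hev : ∀ᶠ b in nhds y, 0 < x ^ 2 + b ^ 2 + 2 * t :=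
    (by fun_prop : Continuous fun b : ℝ => x ^ 2 + b ^ 2 + 2 * t).continuousAt.eventually_const_lt h
  have heq : (fun b => pderivX (fun a b => Real.sqrt (a ^ 2 + b ^ 2 + 2 * t) - 1) x b)
      =ᶠ[nhds y] fun b => x / Real.sqrt (x ^ 2 + b ^ 2 + 2 * t) :=
    hev.mono fun _ hb => pderivX_sqrt hb
  have hw := (Real.sqrt_pos.2 h).ne'
  have hd := hasDerivAt_sqrt_sq_add (a := y) (c := x ^ 2 + 2 * t) (by linarith)
  simp only [← add_assoc, add_comm _ (x ^ 2)] at hd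
  refine heq.deriv_eq.trans (((hasDerivAt_const y x).fun_div hd hw).deriv.trans ?_)
  field_simp
  ring

theorem deriv_time_sqrt {x y t : ℝ} (h : 0 < x ^ 2 + y ^ 2 + 2 * t) :
    deriv (fun s => Real.sqrt (x ^ 2 + y ^ 2 + 2 * s) - 1) t
      = 1 / Real.sqrt (x ^ 2 + y ^ 2 + 2 * t) := by
  have h1 : HasDerivAt (fun s : ℝ => x ^ 2 + y ^ 2 + 2 * s) 2 t := by
    simpa using ((hasDerivAt_id' t).const_mul 2).const_add (x ^ 2 + y ^ 2)
  refine ((h1.sqrt h.ne').sub_const 1).deriv.trans ?_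
  have := (Real.sqrt_pos.2 h).ne'
  field_simp

/-- `u(x,y,t) = √(x² + y² + 2t) − 1` solves the Perona–Malik level-set curvature
equation `∂u/∂t = N(u(·,·,t))` with initial condition `u(x,y,0) = √(x² + y²) − 1`,
and at every point with `(x,y) ≠ (0,0)` and `x² + y² + 2t > 0` its spatial
gradient is nonzero. -/
theorem perona_malik_exact_solution (x y t : ℝ) (hxy : (x, y) ≠ (0, 0))
    (ht : x ^ 2 + y ^ 2 + 2 * t > 0) :
    let u : ℝ → ℝ → ℝ → ℝ := fun x y t => Real.sqrt (x ^ 2 + y ^ 2 + 2 * t) - 1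
    (pderivX (fun a b => u a b t) x y, pderivY (fun a b => u a b t) x y) ≠ (0, 0) ∧
    deriv (fun s => u x y s) t = curvOp (fun a b => u a b t) x y ∧
    u x y 0 = Real.sqrt (x ^ 2 + y ^ 2) - 1 := by
  intro u
  have hw := (Real.sqrt_pos.2 ht).ne'
  have hr : x ^ 2 + y ^ 2 ≠ 0 := by
    intro h
    have hx : x = 0 := by nlinarith [sq_nonneg x, sq_nonneg y]
    have hy : y = 0 := by nlinarith [sq_nonneg x, sq_nonneg y]
    exact hxy (by rw [hx, hy])
  refine ⟨?_, ?_, by simp [u]⟩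
  · simp only [u, pderivX_sqrt ht, pderivY_sqrt ht]
    intro h
    simp only [Prod.mk.injEq, div_eq_zero_iff, hw, or_false] at h
    exact hxy (by rw [h.1, h.2])
  · simp only [u, curvOp, pderivX_sqrt ht, pderivY_sqrt ht, pderivX_pderivX_sqrt ht,
      pderivY_pderivY_sqrt ht, pderivY_pderivX_sqrt ht, deriv_time_sqrt ht]
    have hsq := Real.sq_sqrt ht.le
    generalize Real.sqrt (x ^ 2 + y ^ 2 + 2 * t) = w at hw hsq
    obtain rfl : t = (w ^ 2 - x ^ 2 - y ^ 2) / 2 := by linarith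
    field_simp
    ring
end

section
/- Let u₁(x, y, t) = sqrt(x^2 + y^2) + t / sqrt(x^2 + y^2) − 1. For every (x, y) ∈ ℝ² with (x, y) ≠ (0, 0) and every t ∈ ℝ, the second variational-iteration correction u₂(x, y, t) = u₁(x, y, t) − ∫₀ᵗ ( ∂u₁/∂s (x, y, s) − N(u₁(·,·,s))(x, y) ) ds equals (2x⁴ + 2x²t − 2x² sqrt(x^2+y^2) + 4x²y² + 2y⁴ + 2y²t − t² − 2 sqrt(x^2+y^2) y²) / (2 (x^2 + y^2)^{3/2}), i.e. u₂(x, y, t) = sqrt(x^2+y^2) − 1 + t / sqrt(x^2+y^2) − t² / (2 (x^2+y^2)^{3/2}). -/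
theorem hasDerivAt_sqrt_sq_add_sq {a b : ℝ} (h : a ^ 2 + b ^ 2 ≠ 0) :
    HasDerivAt (fun x => √(x ^ 2 + b ^ 2)) (a / √(a ^ 2 + b ^ 2)) a := by
  refine ((((hasDerivAt_id a).pow 2).add_const (b ^ 2)).sqrt h).congr_deriv ?_
  simp [mul_div_mul_left]

theorem sqrt_sq_add_sq_ne_zero {a b : ℝ} (h : a ^ 2 + b ^ 2 ≠ 0) : √(a ^ 2 + b ^ 2) ≠ 0 :=
  Real.sqrt_ne_zero'.2 (lt_of_le_of_ne (by positivity) h.symm)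

/-- The first iterate of the variational iteration. -/
noncomputable def firstIterate (s a b : ℝ) : ℝ := √(a ^ 2 + b ^ 2) + s / √(a ^ 2 + b ^ 2) - 1

/-- The factor `p` such that the gradient of `firstIterate s` at `(a, b)` is `p • (a, b)`. -/
noncomputable def gradFactor (s a b : ℝ) : ℝ := 1 / √(a ^ 2 + b ^ 2) - s / √(a ^ 2 + b ^ 2) ^ 3

/-- The factor `q` such that the gradient of `gradFactor s` at `(a, b)` is `q • (a, b)`. -/
noncomputable def hessFactor (s a b : ℝ) : ℝ :=
  -1 / √(a ^ 2 + b ^ 2) ^ 3 + 3 * s / √(a ^ 2 + b ^ 2) ^ 5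

theorem firstIterate_comm (s a b : ℝ) : firstIterate s a b = firstIterate s b a := by
  simp only [firstIterate, add_comm (a ^ 2)]

theorem gradFactor_comm (s a b : ℝ) : gradFactor s a b = gradFactor s b a := by
  simp only [gradFactor, add_comm (a ^ 2)]

theorem hessFactor_comm (s a b : ℝ) : hessFactor s a b = hessFactor s b a := by
  simp only [hessFactor, add_comm (a ^ 2)]

theorem hasDerivAt_firstIterate (s : ℝ) {a b : ℝ} (h : a ^ 2 + b ^ 2 ≠ 0) :
    HasDerivAt (fun x => firstIterate s x b) (a * gradFactor s a b) a := by
  have hr := sqrt_sq_add_sq_ne_zero h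
  have hd := hasDerivAt_sqrt_sq_add_sq h
  refine ((hd.add ((hasDerivAt_const a s).div hd hr)).sub_const 1).congr_deriv ?_
  unfold gradFactor
  field_simp
  ring

theorem hasDerivAt_gradFactor (s : ℝ) {a b : ℝ} (h : a ^ 2 + b ^ 2 ≠ 0) :
    HasDerivAt (fun x => gradFactor s x b) (a * hessFactor s a b) a := by
  have hr := sqrt_sq_add_sq_ne_zero h
  have hd := hasDerivAt_sqrt_sq_add_sq h
  refine (((hasDerivAt_const a (1 : ℝ)).div hd hr).sub
    ((hasDerivAt_const a s).div (hd.pow 3) (pow_ne_zero 3 hr))).congr_deriv ?_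
  simp only [hessFactor, Pi.pow_apply]
  field_simp
  push_cast
  ring

theorem pderivX_firstIterate (s : ℝ) {a b : ℝ} (h : a ^ 2 + b ^ 2 ≠ 0) :
    pderivX (firstIterate s) a b = a * gradFactor s a b :=
  (hasDerivAt_firstIterate s h).deriv

theorem pderivY_eq_pderivX_swap (v : ℝ → ℝ → ℝ) (a b : ℝ) :
    pderivY v a b = pderivX (fun x y => v y x) b a := rfl

theorem pderivY_firstIterate (s : ℝ) {a b : ℝ} (h : a ^ 2 + b ^ 2 ≠ 0) :
    pderivY (firstIterate s) a b = b * gradFactor s a b := by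
  rw [pderivY_eq_pderivX_swap, gradFactor_comm,
    ← pderivX_firstIterate s (show b ^ 2 + a ^ 2 ≠ 0 by rwa [add_comm])]
  congr 1
  ext x y
  exact firstIterate_comm s y x

theorem eventually_sq_add_sq_ne_zero {a b : ℝ} (h : a ^ 2 + b ^ 2 ≠ 0) :
    ∀ᶠ x in nhds a, x ^ 2 + b ^ 2 ≠ 0 :=
  ContinuousAt.eventually_ne (by fun_prop) h

theorem pderivX_pderivX_firstIterate (s : ℝ) {a b : ℝ} (h : a ^ 2 + b ^ 2 ≠ 0) :
    pderivX (pderivX (firstIterate s)) a b = gradFactor s a b + a ^ 2 * hessFactor s a b := by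
  have he : (fun x => pderivX (firstIterate s) x b) =ᶠ[nhds a] fun x => x * gradFactor s x b := by
    filter_upwards [eventually_sq_add_sq_ne_zero h] with x hx using pderivX_firstIterate s hx
  have hd := (hasDerivAt_id a).mul (hasDerivAt_gradFactor s h)
  refine (he.deriv_eq.trans hd.deriv).trans ?_
  simp only [id]
  ring

theorem pderivY_pderivX_firstIterate (s : ℝ) {a b : ℝ} (h : a ^ 2 + b ^ 2 ≠ 0) :
    pderivY (pderivX (firstIterate s)) a b = a * b * hessFactor s a b := by
  have h' : b ^ 2 + a ^ 2 ≠ 0 := by rwa [add_comm]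
  have he : (fun y => pderivX (firstIterate s) a y) =ᶠ[nhds b] fun y => a * gradFactor s y a := by
    filter_upwards [eventually_sq_add_sq_ne_zero h'] with y hy
    rw [gradFactor_comm, pderivX_firstIterate s (by rwa [add_comm])]
  refine (he.deriv_eq.trans ((hasDerivAt_gradFactor s h').const_mul a).deriv).trans ?_
  rw [hessFactor_comm]
  ring

theorem pderivY_pderivY_firstIterate (s : ℝ) {a b : ℝ} (h : a ^ 2 + b ^ 2 ≠ 0) :
    pderivY (pderivY (firstIterate s)) a b = gradFactor s a b + b ^ 2 * hessFactor s a b := by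
  rw [gradFactor_comm, hessFactor_comm,
    ← pderivX_pderivX_firstIterate s (show b ^ 2 + a ^ 2 ≠ 0 by rwa [add_comm])]
  simp only [pderivX, pderivY, firstIterate_comm s]

theorem curvOp_firstIterate (s : ℝ) {a b : ℝ} (h : a ^ 2 + b ^ 2 ≠ 0) :
    curvOp (firstIterate s) a b = gradFactor s a b := by
  rw [curvOp, pderivX_pderivX_firstIterate s h, pderivY_pderivX_firstIterate s h,
    pderivY_pderivY_firstIterate s h, pderivX_firstIterate s h, pderivY_firstIterate s h]
  rcases eq_or_ne (gradFactor s a b) 0 with hp | hp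
  · simp [hp]
  · have : (a * gradFactor s a b) ^ 2 + (b * gradFactor s a b) ^ 2 ≠ 0 := by
      rw [mul_pow, mul_pow, ← add_mul]
      exact mul_ne_zero h (pow_ne_zero 2 hp)
    rw [div_eq_iff this]
    ring

/-- The second variational-iteration correction for the Perona–Malik equation,
starting from `u₁(x,y,t) = √(x² + y²) + t/√(x² + y²) − 1`, with Lagrange
multiplier `λ = −1`:
`u₂ = u₁ − ∫₀ᵗ (∂u₁/∂s − N(u₁)) ds
    = (2x⁴ + 2x²t − 2x²√(x²+y²) + 4x²y² + 2y⁴ + 2y²t − t² − 2√(x²+y²) y²)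
        / (2 (x² + y²)^{3/2})
    = √(x²+y²) − 1 + t/√(x²+y²) − t²/(2 (x²+y²)^{3/2})`. -/
theorem vim_second_iterate (x y t : ℝ) (hxy : (x, y) ≠ (0, 0)) :
    let u₁ : ℝ → ℝ → ℝ → ℝ := fun x y t =>
      Real.sqrt (x ^ 2 + y ^ 2) + t / Real.sqrt (x ^ 2 + y ^ 2) - 1
    u₁ x y t - (∫ s in (0:ℝ)..t,
        (deriv (fun s' => u₁ x y s') s - curvOp (fun a b => u₁ a b s) x y))
      = (2 * x ^ 4 + 2 * x ^ 2 * t - 2 * x ^ 2 * Real.sqrt (x ^ 2 + y ^ 2)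
          + 4 * x ^ 2 * y ^ 2 + 2 * y ^ 4 + 2 * y ^ 2 * t - t ^ 2
          - 2 * Real.sqrt (x ^ 2 + y ^ 2) * y ^ 2)
        / (2 * (x ^ 2 + y ^ 2) ^ ((3 : ℝ) / 2)) ∧
    u₁ x y t - (∫ s in (0:ℝ)..t,
        (deriv (fun s' => u₁ x y s') s - curvOp (fun a b => u₁ a b s) x y))
      = Real.sqrt (x ^ 2 + y ^ 2) - 1 + t / Real.sqrt (x ^ 2 + y ^ 2)
          - t ^ 2 / (2 * (x ^ 2 + y ^ 2) ^ ((3 : ℝ) / 2)) := by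
  intro u₁
  have h : x ^ 2 + y ^ 2 ≠ 0 := by
    contrapose! hxy
    have hx : x = 0 := by nlinarith [sq_nonneg x, sq_nonneg y]
    have hy : y = 0 := by nlinarith [sq_nonneg x, sq_nonneg y]
    rw [hx, hy]
  have hr := sqrt_sq_add_sq_ne_zero h
  have hsq : √(x ^ 2 + y ^ 2) ^ 2 = x ^ 2 + y ^ 2 := Real.sq_sqrt (by positivity)
  have hpow : (x ^ 2 + y ^ 2) ^ ((3 : ℝ) / 2) = √(x ^ 2 + y ^ 2) ^ 3 := by
    rw [Real.sqrt_eq_rpow, ← Real.rpow_mul_natCast (by positivity)]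
    norm_num
  have hint : ∀ s, deriv (fun s' => u₁ x y s') s - curvOp (fun a b => u₁ a b s) x y
      = s / √(x ^ 2 + y ^ 2) ^ 3 := by
    intro s
    have hs : deriv (fun s' => u₁ x y s') s = 1 / √(x ^ 2 + y ^ 2) :=
      ((((hasDerivAt_id s).div_const _).const_add _).sub_const 1).deriv
    have hc : curvOp (fun a b => u₁ a b s) x y = gradFactor s x y := curvOp_firstIterate s h
    rw [hs, hc, gradFactor]
    ring
  have hu : u₁ x y t = √(x ^ 2 + y ^ 2) + t / √(x ^ 2 + y ^ 2) - 1 := rfl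
  simp only [hint, hu, hpow, intervalIntegral.integral_div, integral_id]
  constructor
  · have hx : x ^ 2 = √(x ^ 2 + y ^ 2) ^ 2 - y ^ 2 := by rw [hsq]; ring
    generalize √(x ^ 2 + y ^ 2) = r at hr hx ⊢
    rw [show x ^ 4 = (x ^ 2) ^ 2 by ring, hx]
    field_simp
    ring
  · field_simp
    ring
end

section
/- Let u₂(x, y, t) = sqrt(x^2+y^2) − 1 + t / sqrt(x^2+y^2) − t² / (2 (x^2+y^2)^{3/2}). For every (x, y) ∈ ℝ² with (x, y) ≠ (0, 0) and every t ∈ ℝ, the third variational-iteration correction u₃(x, y, t) = u₂(x, y, t) − ∫₀ᵗ ( ∂u₂/∂s (x, y, s) − N(u₂(·,·,s))(x, y) ) ds equals (2x⁶ + 6x⁴y² − 2 sqrt(x^2+y^2) x⁴ + 2tx⁴ + 6y⁴x² − 4 sqrt(x^2+y^2) x²y² − x²t² + 4x²y²t − 2 sqrt(x^2+y^2) y⁴ + t³ + 2y⁴t − t²y² + 2y⁶) / (2 (x^2 + y^2)^{5/2}), i.e. u₃(x, y, t) = sqrt(x^2+y^2) − 1 + t / sqrt(x^2+y^2) − t²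 / (2 (x^2+y^2)^{3/2}) + t³ / (2 (x^2+y^2)^{5/2}). -/
/-- The `x`-derivative of a radial function `F (x² + y²)`. -/
lemma pderivX_radial {F F' : ℝ → ℝ} (hF : ∀ q, 0 < q → HasDerivAt F (F' q) q) {x y : ℝ}
    (h : 0 < x ^ 2 + y ^ 2) :
    pderivX (fun a b => F (a ^ 2 + b ^ 2)) x y = 2 * x * F' (x ^ 2 + y ^ 2) := by
  have h1 : HasDerivAt (fun a : ℝ => a ^ 2 + y ^ 2) (2 * x) x := by
    simpa using (hasDerivAt_pow 2 x).add_const (y ^ 2)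
  exact ((hF _ h).comp x h1).deriv.trans (mul_comm _ _)

/-- The `y`-derivative of a radial function `F (x² + y²)`. -/
lemma pderivY_radial {F F' : ℝ → ℝ} (hF : ∀ q, 0 < q → HasDerivAt F (F' q) q) {x y : ℝ}
    (h : 0 < x ^ 2 + y ^ 2) :
    pderivY (fun a b => F (a ^ 2 + b ^ 2)) x y = 2 * y * F' (x ^ 2 + y ^ 2) := by
  have h1 : HasDerivAt (fun b : ℝ => x ^ 2 + b ^ 2) (2 * y) y := by
    simpa using (hasDerivAt_pow 2 y).const_add (x ^ 2)
  exact ((hF _ h).comp y h1).deriv.trans (mul_comm _ _)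

open Filter Topology in
/-- The curvature operator of a radial function `F (x² + y²)` is `2 F' (x² + y²)`, at points where
the gradient does not vanish. -/
lemma curvOp_radial {F F' F'' : ℝ → ℝ} (hF : ∀ q, 0 < q → HasDerivAt F (F' q) q)
    (hF' : ∀ q, 0 < q → HasDerivAt F' (F'' q) q) {x y : ℝ} (h : 0 < x ^ 2 + y ^ 2)
    (hne : F' (x ^ 2 + y ^ 2) ≠ 0) :
    curvOp (fun a b => F (a ^ 2 + b ^ 2)) x y = 2 * F' (x ^ 2 + y ^ 2) := by
  have hX : ∀ᶠ a in 𝓝 x, 0 < a ^ 2 + y ^ 2 :=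
    (show ContinuousAt (fun a : ℝ => a ^ 2 + y ^ 2) x by fun_prop).eventually (lt_mem_nhds h)
  have hY : ∀ᶠ b in 𝓝 y, 0 < x ^ 2 + b ^ 2 :=
    (show ContinuousAt (fun b : ℝ => x ^ 2 + b ^ 2) y by fun_prop).eventually (lt_mem_nhds h)
  have dX : HasDerivAt (fun a : ℝ => a ^ 2 + y ^ 2) (2 * x) x := by
    simpa using (hasDerivAt_pow 2 x).add_const (y ^ 2)
  have dY : HasDerivAt (fun b : ℝ => x ^ 2 + b ^ 2) (2 * y) y := by
    simpa using (hasDerivAt_pow 2 y).const_add (x ^ 2)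
  have eXX : pderivX (pderivX fun a b => F (a ^ 2 + b ^ 2)) x y
      = 2 * F' (x ^ 2 + y ^ 2) + 4 * x ^ 2 * F'' (x ^ 2 + y ^ 2) := by
    have e : (fun a => pderivX (fun a b => F (a ^ 2 + b ^ 2)) a y)
        =ᶠ[𝓝 x] fun a => 2 * a * F' (a ^ 2 + y ^ 2) :=
      hX.mono fun a ha => pderivX_radial hF ha
    have d := ((hasDerivAt_id x).const_mul 2).mul ((hF' _ h).comp x dX)
    refine e.deriv_eq.trans (d.deriv.trans ?_)
    simp only [Function.comp_apply, id]
    ring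
  have eXY : pderivY (pderivX fun a b => F (a ^ 2 + b ^ 2)) x y
      = 4 * x * y * F'' (x ^ 2 + y ^ 2) := by
    have e : (fun b => pderivX (fun a b => F (a ^ 2 + b ^ 2)) x b)
        =ᶠ[𝓝 y] fun b => 2 * x * F' (x ^ 2 + b ^ 2) :=
      hY.mono fun b hb => pderivX_radial hF hb
    have d := ((hF' _ h).comp y dY).const_mul (2 * x)
    refine e.deriv_eq.trans (d.deriv.trans ?_)
    ring
  have eYY : pderivY (pderivY fun a b => F (a ^ 2 + b ^ 2)) x y
      = 2 * F' (x ^ 2 + y ^ 2) + 4 * y ^ 2 * F'' (x ^ 2 + y ^ 2) := by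
    have e : (fun b => pderivY (fun a b => F (a ^ 2 + b ^ 2)) x b)
        =ᶠ[𝓝 y] fun b => 2 * b * F' (x ^ 2 + b ^ 2) :=
      hY.mono fun b hb => pderivY_radial hF hb
    have d := ((hasDerivAt_id y).const_mul 2).mul ((hF' _ h).comp y dY)
    refine e.deriv_eq.trans (d.deriv.trans ?_)
    simp only [Function.comp_apply, id]
    ring
  have hden : (2 * x * F' (x ^ 2 + y ^ 2)) ^ 2 + (2 * y * F' (x ^ 2 + y ^ 2)) ^ 2 ≠ 0 := by
    have : (2 * x * F' (x ^ 2 + y ^ 2)) ^ 2 + (2 * y * F' (x ^ 2 + y ^ 2)) ^ 2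
        = 4 * (x ^ 2 + y ^ 2) * F' (x ^ 2 + y ^ 2) ^ 2 := by ring
    rw [this]
    positivity
  rw [curvOp, eXX, eXY, eYY, pderivX_radial hF h, pderivY_radial hF h, div_eq_iff hden]
  ring

lemma rpow_three_halves {q : ℝ} (hq : 0 < q) : q ^ ((3 : ℝ) / 2) = √q ^ 3 := by
  rw [Real.sqrt_eq_rpow, ← Real.rpow_mul_natCast hq.le]
  norm_num

lemma rpow_five_halves {q : ℝ} (hq : 0 < q) : q ^ ((5 : ℝ) / 2) = √q ^ 5 := by
  rw [Real.sqrt_eq_rpow, ← Real.rpow_mul_natCast hq.le]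
  norm_num

/-- The second iterate as a function of `q = x² + y²`, together with its derivative. -/
lemma hasDerivAt_radial_iterate (s : ℝ) {q : ℝ} (hq : 0 < q) :
    HasDerivAt (fun q : ℝ => √q - 1 + s / √q - s ^ 2 / (2 * q ^ ((3 : ℝ) / 2)))
      (1 / (2 * √q) - s / (2 * √q ^ 3) + 3 * s ^ 2 / (4 * √q ^ 5)) q := by
  have hr : 0 < √q := Real.sqrt_pos.2 hq
  have d := (Real.hasDerivAt_sqrt hq.ne')
  have d3 := Real.hasDerivAt_rpow_const (p := (3 : ℝ) / 2) (Or.inl hq.ne')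
  have e : q ^ ((3 : ℝ) / 2 - 1) = √q := by
    rw [Real.sqrt_eq_rpow]
    norm_num
  have D := ((d.sub_const 1).add ((hasDerivAt_const q s).div d hr.ne')).sub
    ((hasDerivAt_const q (s ^ 2)).div (d3.const_mul 2)
      (mul_pos two_pos (Real.rpow_pos_of_pos hq _)).ne')
  refine D.congr_deriv ?_
  rw [e, rpow_three_halves hq]
  field_simp
  ring

/-- The third variational-iteration correction for the Perona–Malik equation,
starting from `u₂(x,y,t) = √(x²+y²) − 1 + t/√(x²+y²) − t²/(2 (x²+y²)^{3/2})`,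
with Lagrange multiplier `λ = −1`:
`u₃ = u₂ − ∫₀ᵗ (∂u₂/∂s − N(u₂)) ds
    = (2x⁶ + 6x⁴y² − 2√(x²+y²)x⁴ + 2tx⁴ + 6y⁴x² − 4√(x²+y²)x²y² − x²t² + 4x²y²t
        − 2√(x²+y²)y⁴ + t³ + 2y⁴t − t²y² + 2y⁶) / (2 (x² + y²)^{5/2})
    = √(x²+y²) − 1 + t/√(x²+y²) − t²/(2 (x²+y²)^{3/2}) + t³/(2 (x²+y²)^{5/2})`. -/
theorem vim_third_iterate (x y t : ℝ) (hxy : (x, y) ≠ (0, 0)) :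
    let u₂ : ℝ → ℝ → ℝ → ℝ := fun x y t =>
      Real.sqrt (x ^ 2 + y ^ 2) - 1 + t / Real.sqrt (x ^ 2 + y ^ 2)
        - t ^ 2 / (2 * (x ^ 2 + y ^ 2) ^ ((3 : ℝ) / 2))
    u₂ x y t - (∫ s in (0:ℝ)..t,
        (deriv (fun s' => u₂ x y s') s - curvOp (fun a b => u₂ a b s) x y))
      = (2 * x ^ 6 + 6 * x ^ 4 * y ^ 2 - 2 * Real.sqrt (x ^ 2 + y ^ 2) * x ^ 4
          + 2 * t * x ^ 4 + 6 * y ^ 4 * x ^ 2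
          - 4 * Real.sqrt (x ^ 2 + y ^ 2) * x ^ 2 * y ^ 2 - x ^ 2 * t ^ 2
          + 4 * x ^ 2 * y ^ 2 * t - 2 * Real.sqrt (x ^ 2 + y ^ 2) * y ^ 4 + t ^ 3
          + 2 * y ^ 4 * t - t ^ 2 * y ^ 2 + 2 * y ^ 6)
        / (2 * (x ^ 2 + y ^ 2) ^ ((5 : ℝ) / 2)) ∧
    u₂ x y t - (∫ s in (0:ℝ)..t,
        (deriv (fun s' => u₂ x y s') s - curvOp (fun a b => u₂ a b s) x y))
      = Real.sqrt (x ^ 2 + y ^ 2) - 1 + t / Real.sqrt (x ^ 2 + y ^ 2)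
          - t ^ 2 / (2 * (x ^ 2 + y ^ 2) ^ ((3 : ℝ) / 2))
          + t ^ 3 / (2 * (x ^ 2 + y ^ 2) ^ ((5 : ℝ) / 2)) := by
  intro u₂
  have hq : 0 < x ^ 2 + y ^ 2 := by
    by_contra! hle
    exact hxy (Prod.ext (by nlinarith [sq_nonneg x, sq_nonneg y])
      (by nlinarith [sq_nonneg x, sq_nonneg y]))
  have hr : 0 < √(x ^ 2 + y ^ 2) := Real.sqrt_pos.2 hq
  have hr2 : √(x ^ 2 + y ^ 2) ^ 2 = x ^ 2 + y ^ 2 := Real.sq_sqrt hq.le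
  have hcurv : ∀ s, curvOp (fun a b => u₂ a b s) x y = 2 * (1 / (2 * √(x ^ 2 + y ^ 2))
      - s / (2 * √(x ^ 2 + y ^ 2) ^ 3) + 3 * s ^ 2 / (4 * √(x ^ 2 + y ^ 2) ^ 5)) := by
    intro s
    refine curvOp_radial (fun q hq => hasDerivAt_radial_iterate s hq)
      (fun q hq => DifferentiableAt.hasDerivAt ?_) hq ?_
    · have := Real.sqrt_pos.2 hq
      have h0 := hq.ne'
      fun_prop (disch := first | assumption | positivity)
    · generalize √(x ^ 2 + y ^ 2) = r at hr
      have e : 1 / (2 * r) - s / (2 * r ^ 3) + 3 * s ^ 2 / (4 * r ^ 5)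
          = ((r ^ 2 - s) ^ 2 + r ^ 4 + 2 * s ^ 2) / (4 * r ^ 5) := by
        field_simp
        ring
      rw [e]
      positivity
  have hderiv : ∀ s, deriv (fun s' => u₂ x y s') s
      = 1 / √(x ^ 2 + y ^ 2) - s / √(x ^ 2 + y ^ 2) ^ 3 := by
    intro s
    have d := (((hasDerivAt_id s).div_const √(x ^ 2 + y ^ 2)).const_add
      (√(x ^ 2 + y ^ 2) - 1)).sub
      ((hasDerivAt_pow 2 s).div_const (2 * (x ^ 2 + y ^ 2) ^ ((3 : ℝ) / 2)))
    refine d.deriv.trans ?_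
    rw [rpow_three_halves hq]
    field_simp
    norm_num
    ring
  have hint : (∫ s in (0 : ℝ)..t,
      (deriv (fun s' => u₂ x y s') s - curvOp (fun a b => u₂ a b s) x y))
      = -(t ^ 3 / (2 * √(x ^ 2 + y ^ 2) ^ 5)) := by
    have e : ∀ s, deriv (fun s' => u₂ x y s') s - curvOp (fun a b => u₂ a b s) x y
        = -(3 / (2 * √(x ^ 2 + y ^ 2) ^ 5)) * s ^ 2 := by
      intro s
      rw [hcurv, hderiv]
      field_simp
      ring
    simp_rw [e]
    rw [intervalIntegral.integral_const_mul, integral_pow]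
    push_cast
    field_simp
    ring
  rw [hint, rpow_five_halves hq]
  refine ⟨?_, by simp only [u₂]; ring⟩
  simp only [u₂]
  rw [rpow_three_halves hq]
  generalize √(x ^ 2 + y ^ 2) = r at hr hr2
  field_simp
  have hx : x ^ 2 = r ^ 2 - y ^ 2 := by linarith
  rw [hx]
  ring
end
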